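/- arXiv:2311.07952 — 5 statements merged into one kernel-verified Lean document; each statement's English description precedes it below -/
import Mathlib

section
/- Suppose Assumptions 1 and 3 hold. Let τ > 0 and let e : [0,τ) → B_op(σ₀R) be continuous. If the ODE ẋ(t) = F(x(t), e(t)) with x(0) = x₀ ∈ B_cl(R) has a solution x on [0,τ] such that x(t) ∈ B_cl(R) for all t ∈ [0,τ), then ‖x(t)‖_cl ≤ e^{−ct}‖x₀‖_cl + (α(1−e^{−ct})/c)·sup_{0≤s<τ}‖e(s)‖_op for all t ∈ [0,τ]. -/
set_option autoImplicit false

open Filter Set MeasureTheory Real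
open scoped Topology ENNReal

noncomputable section

/-- `N` is a norm on `ℝ^n`. -/
structure IsVecNorm {n : ℕ} (N : (Fin n → ℝ) → ℝ) : Prop where
  eq_zero : ∀ x, N x = 0 ↔ x = 0
  smul_eq : ∀ (a : ℝ) (x : Fin n → ℝ), N (a • x) = |a| * N x
  add_le : ∀ x y : Fin n → ℝ, N (x + y) ≤ N x + N y

/-- The matrix norm induced by the vector norm `N`. -/
def matNorm {n : ℕ} (N : (Fin n → ℝ) → ℝ) (A : Matrix (Fin n) (Fin n) ℝ) : ℝ :=
  sSup {c : ℝ | ∃ x : Fin n → ℝ, N x = 1 ∧ c = N (A.mulVec x)}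

/-- The logarithmic norm `μ_N(A) = lim_{ε→0⁺} (‖I+εA‖_N − 1)/ε`. -/
def logNorm {n : ℕ} (N : (Fin n → ℝ) → ℝ) (A : Matrix (Fin n) (Fin n) ℝ) : ℝ :=
  limUnder (𝓝[>] (0 : ℝ)) (fun ε : ℝ => (matNorm N (1 + ε • A) - 1) / ε)

/-- The Jacobian matrix of `F` at `x`. -/
def jacobian {n : ℕ} (F : (Fin n → ℝ) → (Fin n → ℝ)) (x : Fin n → ℝ) :
    Matrix (Fin n) (Fin n) ℝ :=
  Matrix.of fun i j => fderiv ℝ F x (Pi.single j 1) i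

/-- Open ball of radius `r` centered at `0` w.r.t. the norm `N`. -/
def nball {n : ℕ} (N : (Fin n → ℝ) → ℝ) (r : ℝ) : Set (Fin n → ℝ) := {x | N x < r}

/-- `ν(t) = d₂ ∫₀ᵗ e^{d₁ s} ds`. -/
def nu (d₁ d₂ t : ℝ) : ℝ := d₂ * ∫ s in (0:ℝ)..t, Real.exp (d₁ * s)

/-- Diagonally-weighted r-norm `‖x‖_{r,[θ]} = ‖[θ]x‖_r`. -/
def wnorm {n : ℕ} (r : ℝ≥0∞) (θ x : Fin n → ℝ) : ℝ :=
  ‖(WithLp.equiv r (∀ _ : Fin n, ℝ)).symm (fun i => θ i * x i)‖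

namespace IsVecNorm

variable {n : ℕ} {N : (Fin n → ℝ) → ℝ}

lemma map_zero (h : IsVecNorm N) : N 0 = 0 := (h.eq_zero 0).2 rfl

lemma map_neg (h : IsVecNorm N) (x : Fin n → ℝ) : N (-x) = N x := by
  have := h.smul_eq (-1) x
  simpa using this

lemma nonneg (h : IsVecNorm N) (x : Fin n → ℝ) : 0 ≤ N x := by
  have h1 := h.add_le x (-x)
  rw [h.map_neg, add_neg_cancel, h.map_zero] at h1
  linarith

lemma sub_le (h : IsVecNorm N) (x y : Fin n → ℝ) : N x - N y ≤ N (x - y) := by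
  have h1 := h.add_le (x - y) y
  rw [sub_add_cancel] at h1
  linarith

lemma sum_le (h : IsVecNorm N) {ι : Type*} (s : Finset ι) (v : ι → (Fin n → ℝ)) :
    N (∑ i ∈ s, v i) ≤ ∑ i ∈ s, N (v i) := by
  classical
  induction s using Finset.induction_on with
  | empty => simp [h.map_zero]
  | insert a s ha ih =>
    rw [Finset.sum_insert ha, Finset.sum_insert ha]
    exact (h.add_le _ _).trans (by linarith)

lemma exists_upper (h : IsVecNorm N) : ∃ C : ℝ, 0 ≤ C ∧ ∀ x, N x ≤ C * ‖x‖ := by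
  refine ⟨∑ i, N (Pi.single i 1), Finset.sum_nonneg fun i _ => h.nonneg _, fun x => ?_⟩
  have hx : x = ∑ i, x i • (Pi.single i (1 : ℝ) : Fin n → ℝ) := by
    ext j
    simp [Finset.sum_apply, Pi.single_apply]
  calc N x = N (∑ i, x i • (Pi.single i (1 : ℝ) : Fin n → ℝ)) := by rw [← hx]
    _ ≤ ∑ i, N (x i • (Pi.single i (1 : ℝ) : Fin n → ℝ)) := h.sum_le _ _
    _ ≤ ∑ i, N (Pi.single i 1) * ‖x‖ := by
      refine Finset.sum_le_sum fun i _ => ?_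
      rw [h.smul_eq, mul_comm]
      exact mul_le_mul_of_nonneg_left (norm_le_pi_norm x i) (h.nonneg _)
    _ = _ := by rw [Finset.sum_mul]

lemma continuous (h : IsVecNorm N) : Continuous N := by
  obtain ⟨C, hC, hN⟩ := h.exists_upper
  have : LipschitzWith (C.toNNReal) N := by
    refine LipschitzWith.of_le_add_mul _ fun x y => ?_
    have h1 := h.sub_le x y
    have h2 := hN (x - y)
    rw [dist_eq_norm]
    rw [Real.coe_toNNReal C hC]
    linarith
  exact this.continuous

lemma exists_lower (h : IsVecNorm N) : ∃ k : ℝ, 0 < k ∧ ∀ x, k * ‖x‖ ≤ N x := by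
  rcases (Metric.sphere (0 : Fin n → ℝ) 1).eq_empty_or_nonempty with he | hne
  · refine ⟨1, one_pos, fun x => ?_⟩
    by_cases hx : x = 0
    · simp [hx, h.map_zero]
    · exfalso
      have : (‖x‖⁻¹ • x) ∈ Metric.sphere (0 : Fin n → ℝ) 1 := by
        simp [norm_smul, norm_ne_zero_iff.2 hx]
      rw [he] at this
      exact this
  · obtain ⟨y, hy, hmin⟩ := (isCompact_sphere (0 : Fin n → ℝ) 1).exists_isMinOn hne
      h.continuous.continuousOn
    have hy1 : ‖y‖ = 1 := by simpa using hy
    have hy0 : y ≠ 0 := by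
      rintro rfl
      simp at hy1
    refine ⟨N y, lt_of_le_of_ne (h.nonneg y) (fun h0 => hy0 ((h.eq_zero y).1 h0.symm)), fun x => ?_⟩
    by_cases hx : x = 0
    · simp [hx, h.map_zero]
    · have hxn : 0 < ‖x‖ := norm_pos_iff.2 hx
      have hmem : (‖x‖⁻¹ • x) ∈ Metric.sphere (0 : Fin n → ℝ) 1 := by
        simp [norm_smul, norm_ne_zero_iff.2 hx]
      have h1 : N y ≤ N (‖x‖⁻¹ • x) := hmin hmem
      rw [h.smul_eq, abs_of_pos (inv_pos.2 hxn)] at h1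
      calc N y * ‖x‖ ≤ (‖x‖⁻¹ * N x) * ‖x‖ := mul_le_mul_of_nonneg_right h1 hxn.le
        _ = N x := by field_simp

lemma bddAbove_mat (h : IsVecNorm N) (A : Matrix (Fin n) (Fin n) ℝ) :
    BddAbove {c : ℝ | ∃ x : Fin n → ℝ, N x = 1 ∧ c = N (A.mulVec x)} := by
  obtain ⟨C, hC, hN⟩ := h.exists_upper
  obtain ⟨k, hk, hl⟩ := h.exists_lower
  let T : (Fin n → ℝ) →L[ℝ] (Fin n → ℝ) := LinearMap.toContinuousLinearMap (Matrix.toLin' A)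
  refine ⟨C * (‖T‖ * k⁻¹), ?_⟩
  rintro c ⟨x, hx, rfl⟩
  have h1 : A.mulVec x = T x := by simp [T]
  have h2 : ‖x‖ ≤ k⁻¹ := by
    have := hl x
    rw [hx] at this
    rw [← one_div, le_div_iff₀ hk]
    linarith
  rw [h1]
  refine (hN _).trans (mul_le_mul_of_nonneg_left ?_ hC)
  exact (T.le_opNorm x).trans (mul_le_mul_of_nonneg_left h2 (norm_nonneg _))

lemma mulVec_le (h : IsVecNorm N) (A : Matrix (Fin n) (Fin n) ℝ) (x : Fin n → ℝ) :
    N (A.mulVec x) ≤ matNorm N A * N x := by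
  by_cases hx : x = 0
  · simp [hx, h.map_zero]
  · have hN : 0 < N x := lt_of_le_of_ne (h.nonneg x) (fun h0 => hx ((h.eq_zero x).1 h0.symm))
    have h1 : N (A.mulVec ((N x)⁻¹ • x)) ≤ matNorm N A := by
      refine le_csSup (h.bddAbove_mat A) ⟨_, ?_, rfl⟩
      rw [h.smul_eq, abs_of_pos (inv_pos.2 hN), inv_mul_cancel₀ hN.ne']
    rw [Matrix.mulVec_smul, h.smul_eq, abs_of_pos (inv_pos.2 hN)] at h1
    calc N (A.mulVec x) = ((N x)⁻¹ * N (A.mulVec x)) * N x := by field_simp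
      _ ≤ _ := mul_le_mul_of_nonneg_right h1 hN.le

lemma matNorm_nonneg (h : IsVecNorm N) (A : Matrix (Fin n) (Fin n) ℝ) : 0 ≤ matNorm N A := by
  apply Real.sSup_nonneg
  rintro c ⟨x, -, rfl⟩
  exact h.nonneg _

lemma slope_mono (h : IsVecNorm N) (A : Matrix (Fin n) (Fin n) ℝ) {ε δ : ℝ} (hε : 0 < ε)
    (hεδ : ε ≤ δ) :
    (matNorm N (1 + ε • A) - 1) / ε ≤ (matNorm N (1 + δ • A) - 1) / δ := by
  have hδ : 0 < δ := hε.trans_le hεδ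
  have hr1 : ε / δ ≤ 1 := (div_le_one hδ).2 hεδ
  have hr0 : 0 ≤ ε / δ := by positivity
  have key : matNorm N (1 + ε • A) ≤ (1 - ε / δ) + (ε / δ) * matNorm N (1 + δ • A) := by
    refine Real.sSup_le ?_ ?_
    · rintro c ⟨x, hx, rfl⟩
      have e1 : (1 + ε • A).mulVec x = (1 - ε / δ) • x + (ε / δ) • ((1 + δ • A).mulVec x) := by
        simp only [Matrix.add_mulVec, Matrix.one_mulVec, Matrix.smul_mulVec, smul_add, smul_smul,
          sub_smul, one_smul]
        rw [div_mul_cancel₀ _ hδ.ne']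
        abel
      rw [e1]
      refine (h.add_le _ _).trans ?_
      rw [h.smul_eq, h.smul_eq, abs_of_nonneg hr0, abs_of_nonneg (by linarith), hx, mul_one]
      have := h.mulVec_le (1 + δ • A) x
      rw [hx, mul_one] at this
      have := mul_le_mul_of_nonneg_left this hr0
      linarith
    · have := mul_nonneg hr0 (h.matNorm_nonneg (1 + δ • A))
      linarith
  rw [div_le_iff₀ hε]
  calc matNorm N (1 + ε • A) - 1 ≤ (1 - ε / δ) + (ε / δ) * matNorm N (1 + δ • A) - 1 := by linarith
    _ = _ := by ring

lemma exists_unit (h : IsVecNorm N) (hn : 0 < n) : ∃ x, N x = 1 := by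
  let y : Fin n → ℝ := fun _ => 1
  have hy : y ≠ 0 := fun h0 => by
    have := congrFun h0 ⟨0, hn⟩
    simp [y] at this
  have hN : 0 < N y := lt_of_le_of_ne (h.nonneg y) (fun h0 => hy ((h.eq_zero y).1 h0.symm))
  refine ⟨(N y)⁻¹ • y, ?_⟩
  rw [h.smul_eq, abs_of_pos (inv_pos.2 hN), inv_mul_cancel₀ hN.ne']

lemma tendsto_logNorm (h : IsVecNorm N) (hn : 0 < n) (A : Matrix (Fin n) (Fin n) ℝ) :
    Tendsto (fun ε : ℝ => (matNorm N (1 + ε • A) - 1) / ε) (𝓝[>] (0 : ℝ)) (𝓝 (logNorm N A)) := by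
  have h1 : Tendsto (fun ε : ℝ => (matNorm N (1 + ε • A) - 1) / ε) (𝓝[>] (0 : ℝ))
      (𝓝 (sInf ((fun ε : ℝ => (matNorm N (1 + ε • A) - 1) / ε) '' Ioi 0))) := by
    apply MonotoneOn.tendsto_nhdsGT
    · intro a ha b _ hab
      exact h.slope_mono A ha hab
    · obtain ⟨x, hx⟩ := h.exists_unit hn
      refine ⟨- N (A.mulVec x), ?_⟩
      rintro _ ⟨ε, hε, rfl⟩
      have hε' : 0 < ε := hε
      show _ ≤ (matNorm N (1 + ε • A) - 1) / ε
      rw [le_div_iff₀ hε']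
      have h2 := h.mulVec_le (1 + ε • A) x
      rw [hx, mul_one, Matrix.add_mulVec, Matrix.one_mulVec, Matrix.smul_mulVec] at h2
      have h3 := h.sub_le x (-(ε • A.mulVec x))
      rw [h.map_neg, h.smul_eq, abs_of_pos hε', sub_neg_eq_add, hx] at h3
      linarith
  have : logNorm N A = sInf ((fun ε : ℝ => (matNorm N (1 + ε • A) - 1) / ε) '' Ioi 0) :=
    h1.limUnder_eq
  rw [this]
  exact h1

/-- Support functional. -/
lemma exists_support (h : IsVecNorm N) (x : Fin n → ℝ) :
    ∃ l : (Fin n → ℝ) →ₗ[ℝ] ℝ, (∀ y, l y ≤ N y) ∧ l x = N x := by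
  by_cases hx : x = 0
  · refine ⟨0, fun y => by simpa using h.nonneg y, by simp [hx, h.map_zero]⟩
  · obtain ⟨l, hl1, hl2⟩ := exists_extension_of_le_sublinear
      (LinearPMap.mkSpanSingleton (K := ℝ) x (N x) hx) N
      (fun c hc y => by rw [h.smul_eq, abs_of_pos hc]) h.add_le (by
        rintro ⟨y, hy⟩
        obtain ⟨a, rfl⟩ := Submodule.mem_span_singleton.1 hy
        have e1 : (LinearPMap.mkSpanSingleton (K := ℝ) x (N x) hx) ⟨a • x, hy⟩ = a • N x :=
          LinearPMap.mkSpanSingleton'_apply _ _ _ _ _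
        rw [e1]
        show a • N x ≤ N (a • x)
        rw [h.smul_eq, smul_eq_mul]
        exact mul_le_mul_of_nonneg_right (le_abs_self a) (h.nonneg x))
    refine ⟨l, hl2, ?_⟩
    have := hl1 ⟨x, Submodule.mem_span_singleton_self x⟩
    rw [LinearPMap.mkSpanSingleton_apply] at this
    exact this

lemma support_mulVec_le (h : IsVecNorm N) (hn : 0 < n) (A : Matrix (Fin n) (Fin n) ℝ)
    (x : Fin n → ℝ) (l : (Fin n → ℝ) →ₗ[ℝ] ℝ) (hl : ∀ y, l y ≤ N y) (hlx : l x = N x) :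
    l (A.mulVec x) ≤ logNorm N A * N x := by
  refine ge_of_tendsto ((h.tendsto_logNorm hn A).mul_const (N x)) ?_
  filter_upwards [self_mem_nhdsWithin] with ε hε
  have hε' : 0 < ε := hε
  have h1 := (hl _).trans (h.mulVec_le (1 + ε • A) x)
  rw [Matrix.add_mulVec, Matrix.one_mulVec, Matrix.smul_mulVec, _root_.map_add, hlx,
    _root_.map_smul, smul_eq_mul] at h1
  rw [div_mul_eq_mul_div, le_div_iff₀ hε']
  linarith

end IsVecNorm

lemma jacobian_mulVec {n : ℕ} (F : (Fin n → ℝ) → (Fin n → ℝ)) (x v : Fin n → ℝ) :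
    (jacobian F x).mulVec v = fderiv ℝ F x v := by
  have : jacobian F x = LinearMap.toMatrix' (fderiv ℝ F x : (Fin n → ℝ) →ₗ[ℝ] (Fin n → ℝ)) := by
    ext i j
    rw [LinearMap.toMatrix'_apply]
    simp [jacobian]
  rw [this, LinearMap.toMatrix'_mulVec]
  rfl

/-- Almost every translate of a segment meets a conull set in almost every point. -/
lemma ae_translate {n : ℕ} (p : (Fin n → ℝ) → Prop) (hp : ∀ᵐ y, p y) (x : Fin n → ℝ) :
    ∀ᵐ z : Fin n → ℝ, ∀ᵐ s : ℝ, p (z + s • x) := by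
  obtain ⟨S, hS, hSm, hS0⟩ := exists_measurable_superset_of_null (ae_iff.1 hp)
  have h1 : ∀ᵐ z : Fin n → ℝ, ∀ᵐ s : ℝ, z + s • x ∉ S := by
    rw [Measure.ae_ae_comm]
    · refine Eventually.of_forall fun s => ?_
      have : (∀ᵐ y : Fin n → ℝ, y ∉ S) := measure_eq_zero_iff_ae_notMem.1 hS0
      exact (quasiMeasurePreserving_add_right volume (s • x)).ae this
    · have hm : Measurable (fun q : (Fin n → ℝ) × ℝ => q.1 + q.2 • x) := by fun_prop
      exact hm hSm.compl
  filter_upwards [h1] with z hz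
  filter_upwards [hz] with s hs
  by_contra hcon
  exact hs (hS hcon)

lemma one_sided {n : ℕ} (hn : 0 < n) (F : (Fin n → ℝ) → (Fin n → ℝ)) (hF : Continuous F)
    (hF0 : F 0 = 0) (N : (Fin n → ℝ) → ℝ) (hN : IsVecNorm N) (c R₁ : ℝ)
    (hLip : ∀ x ∈ nball N R₁, ∃ (K : NNReal) (ε : ℝ), 0 < ε ∧
      LipschitzOnWith K F (Metric.ball x ε ∩ nball N R₁))
    (hmu : ∀ᵐ x ∂(volume : Measure (Fin n → ℝ)), x ∈ nball N R₁ →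
      DifferentiableAt ℝ F x ∧ logNorm N (jacobian F x) ≤ -c)
    (x : Fin n → ℝ) (hx : x ∈ nball N R₁)
    (l : (Fin n → ℝ) →ₗ[ℝ] ℝ) (hl : ∀ y, l y ≤ N y) (hlx : l x = N x) :
    l (F x) ≤ -c * N x := by
  have hx' : N x < R₁ := hx
  let L : (Fin n → ℝ) →L[ℝ] ℝ := LinearMap.toContinuousLinearMap l
  have hL : ∀ y, L y = l y := fun y => rfl
  have hLL : LocallyLipschitzOn (nball N R₁) F := by
    intro y hy
    obtain ⟨K, ε, hε, hK⟩ := hLip y hy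
    exact ⟨K, _, Filter.inter_mem (mem_nhdsWithin_of_mem_nhds (Metric.ball_mem_nhds y hε))
      self_mem_nhdsWithin, hK⟩
  have key : ∀ z : Fin n → ℝ, (∀ᵐ s : ℝ, z + s • x ∈ nball N R₁ →
      DifferentiableAt ℝ F (z + s • x) ∧ logNorm N (jacobian F (z + s • x)) ≤ -c) →
      N z < R₁ - N x → L (F (z + x)) - L (F z) ≤ -c * N x := by
    intro z hz hzN
    have hseg : ∀ s ∈ Icc (0:ℝ) 1, z + s • x ∈ nball N R₁ := by
      intro s hs
      have h1 := hN.add_le z (s • x)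
      rw [hN.smul_eq, abs_of_nonneg hs.1] at h1
      have h2 : s * N x ≤ N x := mul_le_of_le_one_left (hN.nonneg x) hs.2
      show N _ < R₁
      linarith
    have hγ : Continuous (fun s : ℝ => z + s • x) := by fun_prop
    have hcpt : IsCompact ((fun s : ℝ => z + s • x) '' Icc 0 1) := isCompact_Icc.image hγ
    obtain ⟨K, hK⟩ := (hLL.mono (s := (fun s : ℝ => z + s • x) '' Icc 0 1) (by
      rintro _ ⟨s, hs, rfl⟩
      exact hseg s hs)).exists_lipschitzOnWith_of_compact hcpt
    have hγL : LipschitzWith ‖x‖₊ (fun s : ℝ => z + s • x) := by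
      refine LipschitzWith.of_dist_le_mul fun a b => ?_
      rw [dist_eq_norm, add_sub_add_left_eq_sub, ← sub_smul, norm_smul, dist_eq_norm, mul_comm]
      rfl
    have hφ : LipschitzOnWith (‖L‖₊ * (K * ‖x‖₊)) (fun s : ℝ => L (F (z + s • x))) (uIcc 0 1) := by
      rw [uIcc_of_le zero_le_one]
      exact L.lipschitz.comp_lipschitzOnWith (hK.comp hγL.lipschitzOnWith (mapsTo_image _ _))
    have hac := hφ.absolutelyContinuousOnInterval
    have hint := hac.integral_deriv_eq_sub
    have hii := hac.intervalIntegrable_deriv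
    have hle : ∫ s in (0:ℝ)..1, deriv (fun s : ℝ => L (F (z + s • x))) s
        ≤ ∫ s in (0:ℝ)..1, (-c * N x) := by
      refine intervalIntegral.integral_mono_ae_restrict zero_le_one hii (by simp) ?_
      rw [EventuallyLE, ae_restrict_iff' measurableSet_Icc]
      filter_upwards [hz] with s hs hsI
      obtain ⟨hd, hm⟩ := hs (hseg s hsI)
      have hγd : HasDerivAt (fun s : ℝ => z + s • x) x s := by
        simpa using ((hasDerivAt_id s).smul_const x).const_add z
      have hFd : HasDerivAt (fun s : ℝ => F (z + s • x)) (fderiv ℝ F (z + s • x) x) s :=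
        hd.hasFDerivAt.comp_hasDerivAt s hγd
      have hLd : HasDerivAt (fun s : ℝ => L (F (z + s • x))) (L (fderiv ℝ F (z + s • x) x)) s :=
        L.hasFDerivAt.comp_hasDerivAt s hFd
      rw [hLd.deriv, ← jacobian_mulVec]
      exact (hN.support_mulVec_le hn _ x l hl hlx).trans
        (mul_le_mul_of_nonneg_right hm (hN.nonneg x))
    rw [hint] at hle
    simpa using hle
  have hdense := Measure.dense_of_ae (ae_translate _ hmu x)
  have hfreq := mem_closure_iff_frequently.1 (hdense 0)
  have hev : ∀ᶠ z in 𝓝 (0 : Fin n → ℝ), N z < R₁ - N x := by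
    apply hN.continuous.continuousAt.eventually_lt_const
    rw [hN.map_zero]
    linarith
  have hcont : Continuous (fun z => L (F (z + x)) - L (F z)) := by fun_prop
  have hlim := hcont.tendsto 0
  have := le_of_tendsto_of_frequently hlim
    ((hfreq.and_eventually hev).mono fun z hz => key z hz.1 hz.2)
  simpa [hF0, hL] using this

/-- Gronwall from a bound on left difference quotients. -/
lemma left_gronwall {φ : ℝ → ℝ} {c K T : ℝ} (hc : 0 < c) (hT : 0 ≤ T)
    (hφ : ContinuousOn φ (Icc 0 T))
    (hd : ∀ t ∈ Ioc 0 T, ∀ r, -c * φ t + K < r → ∀ᶠ s in 𝓝[<] t, φ t - φ s < r * (t - s)) :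
    φ T ≤ Real.exp (-c * T) * φ 0 + K * (1 - Real.exp (-c * T)) / c := by
  have hg := le_gronwallBound_of_liminf_deriv_right_le (f := fun s => -φ (T - s))
    (f' := fun s => c * (-φ (T - s)) + K) (δ := -φ T) (K := c) (ε := K) (a := 0) (b := T)
    (by
      refine (hφ.comp (by fun_prop) ?_).neg
      intro s hs
      exact ⟨by linarith [hs.2], by linarith [hs.1]⟩)
    (by
      intro s hs r hr
      apply Eventually.frequently
      have h1 := hd (T - s) ⟨by linarith [hs.2], by linarith [hs.1]⟩ r (by linarith)
      have h2 : Tendsto (fun z => T - z) (𝓝[>] s) (𝓝[<] (T - s)) := by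
        refine tendsto_nhdsWithin_iff.2 ⟨?_, ?_⟩
        · exact (Continuous.tendsto (by fun_prop) s).mono_left nhdsWithin_le_nhds
        · filter_upwards [self_mem_nhdsWithin] with z hz
          have : s < z := hz
          show T - z < T - s
          linarith
      filter_upwards [h2.eventually h1, self_mem_nhdsWithin] with z hz hsz
      have hpos : 0 < z - s := sub_pos.2 hsz
      rw [inv_mul_lt_iff₀ hpos]
      have : T - s - (T - z) = z - s := by ring
      rw [this] at hz
      linarith)
    (by simp) (by intro s _; exact le_rfl) T ⟨hT, le_rfl⟩
  rw [gronwallBound_of_K_ne_0 hc.ne'] at hg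
  simp only [sub_self, sub_zero] at hg
  have hE : Real.exp (-c * T) * Real.exp (c * T) = 1 := by
    rw [← Real.exp_add]
    simp
  have hEp := Real.exp_pos (-c * T)
  have h3 := mul_le_mul_of_nonneg_left hg hEp.le
  have h4 : Real.exp (-c * T) * (-φ T * Real.exp (c * T) + K / c * (Real.exp (c * T) - 1))
      = -φ T + K * (1 - Real.exp (-c * T)) / c := by
    have : Real.exp (-c * T) * (-φ T * Real.exp (c * T) + K / c * (Real.exp (c * T) - 1))
      = (Real.exp (-c * T) * Real.exp (c * T)) * (-φ T)
        + K / c * (Real.exp (-c * T) * Real.exp (c * T) - Real.exp (-c * T)) := by ring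
    rw [this, hE]
    ring
  rw [h4] at h3
  linarith

theorem stmt0
    {n m : ℕ} (hn : 0 < n) (hm : 0 < m)
    (f : (Fin n → ℝ) → (Fin m → ℝ) → (Fin n → ℝ)) (g : (Fin n → ℝ) → (Fin m → ℝ))
    (hf : Continuous (fun p : (Fin n → ℝ) × (Fin m → ℝ) => f p.1 p.2)) (hg : Continuous g)
    (hf0 : f 0 (g 0) = 0)
    -- Assumption 1
    (Ncl : (Fin n → ℝ) → ℝ) (hNcl : IsVecNorm Ncl) (c R₁ : ℝ) (hc : 0 < c) (hR₁ : 0 < R₁)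
    (hLip : ∀ x ∈ nball Ncl R₁, ∃ (K : NNReal) (ε : ℝ), 0 < ε ∧
      LipschitzOnWith K (fun y => f y (g y)) (Metric.ball x ε ∩ nball Ncl R₁))
    (hmucl : ∀ᵐ x ∂(volume : Measure (Fin n → ℝ)), x ∈ nball Ncl R₁ →
      DifferentiableAt ℝ (fun y => f y (g y)) x ∧
      logNorm Ncl (jacobian (fun y => f y (g y)) x) ≤ -c)
    -- the norm ‖·‖_op and the constant R₂
    (Nop : (Fin n → ℝ) → ℝ) (hNop : IsVecNorm Nop) (R₂ : ℝ) (hR₂ : 0 < R₂)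
    -- the constants Γ and R
    (Γ R : ℝ) (hΓ : 0 < Γ) (hΓle : ∀ x : Fin n → ℝ, Nop x ≤ Γ * Ncl x)
    (hR : R = min R₁ (R₂ / Γ))
    -- Assumption 3
    (α σ₀ : ℝ) (hα : 0 < α) (hσ₀ : 0 < σ₀)
    (hFLip : ∀ x ∈ nball Ncl R, ∀ e ∈ nball Nop (σ₀ * R),
      Ncl (f x (g (x + e)) - f x (g x)) ≤ α * Nop e)
    (τ : ℝ) (hτ : 0 < τ)
    (e : ℝ → (Fin n → ℝ)) (he : ContinuousOn e (Ico 0 τ))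
    (heB : ∀ s ∈ Ico (0:ℝ) τ, e s ∈ nball Nop (σ₀ * R))
    (x₀ : Fin n → ℝ) (hx₀ : x₀ ∈ nball Ncl R)
    (x : ℝ → (Fin n → ℝ)) (hx0 : x 0 = x₀)
    (hode : ∀ t ∈ Icc (0:ℝ) τ, HasDerivWithinAt x (f (x t) (g (x t + e t))) (Icc 0 τ) t)
    (hxB : ∀ t ∈ Ico (0:ℝ) τ, x t ∈ nball Ncl R) :
    ∀ t ∈ Icc (0:ℝ) τ,
      Ncl (x t) ≤ Real.exp (-c * t) * Ncl x₀ +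
        α * (1 - Real.exp (-c * t)) / c * sSup ((fun s => Nop (e s)) '' Ico (0:ℝ) τ) := by
  set M := sSup ((fun s => Nop (e s)) '' Ico (0:ℝ) τ) with hM
  have hMle : ∀ s ∈ Ico (0:ℝ) τ, Nop (e s) ≤ M := by
    intro s hs
    refine le_csSup ⟨σ₀ * R, ?_⟩ ⟨s, hs, rfl⟩
    rintro _ ⟨u, hu, rfl⟩
    exact le_of_lt (heB u hu)
  have hRR : R ≤ R₁ := hR ▸ min_le_left _ _
  have hF : Continuous (fun y => f y (g y)) := hf.comp (continuous_id.prodMk hg)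
  have hxc : ContinuousOn x (Icc 0 τ) := fun t ht => (hode t ht).continuousWithinAt
  have hφc : ContinuousOn (fun t => Ncl (x t)) (Icc 0 τ) := hNcl.continuous.comp_continuousOn hxc
  have hIco : ∀ t ∈ Ico (0:ℝ) τ, Ncl (x t) ≤ Real.exp (-c * t) * Ncl x₀ +
        α * (1 - Real.exp (-c * t)) / c * M := by
    intro T hT
    have hg := left_gronwall (φ := fun t => Ncl (x t)) (K := α * M) hc hT.1
      (hφc.mono (Icc_subset_Icc_right hT.2.le)) (by
        intro t ht r hr
        have htI : t ∈ Ico (0:ℝ) τ := ⟨ht.1.le, ht.2.trans_lt hT.2⟩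
        obtain ⟨l, hl, hlx⟩ := hNcl.exists_support (x t)
        let L : (Fin n → ℝ) →L[ℝ] ℝ := LinearMap.toContinuousLinearMap l
        have hL : ∀ y, L y = l y := fun y => rfl
        have hos := one_sided hn _ hF hf0 Ncl hNcl c R₁ hLip hmucl (x t)
          (lt_of_lt_of_le (hxB t htI) hRR) l hl hlx
        have hdist := hFLip (x t) (hxB t htI) (e t) (heB t htI)
        have hbd : L (f (x t) (g (x t + e t))) < r := by
          have h1 := hl (f (x t) (g (x t + e t)) - f (x t) (g (x t)))
          rw [_root_.map_sub] at h1
          have h2 := mul_le_mul_of_nonneg_left (hMle t htI) hα.le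
          rw [hL]
          beta_reduce at hr hos
          linarith
        have hd : HasDerivAt (fun s => L (x s)) (L (f (x t) (g (x t + e t)))) t :=
          L.hasFDerivAt.comp_hasDerivAt t
            ((hode t ⟨htI.1, htI.2.le⟩).hasDerivAt (Icc_mem_nhds ht.1 htI.2))
        have hsl := (hasDerivAt_iff_tendsto_slope.1 hd).mono_left
          (nhdsWithin_mono t (fun s (hs : s < t) => ne_of_lt hs))
        filter_upwards [hsl.eventually_lt_const hbd, self_mem_nhdsWithin] with s hs hst
        have hst' : 0 < t - s := sub_pos.2 hst
        rw [slope_comm, slope_def_field, div_lt_iff₀ hst'] at hs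
        have := hl (x s)
        rw [hL, hL, hlx] at hs
        show Ncl (x t) - Ncl (x s) < _
        linarith)
    simp only [hx0] at hg
    calc _ ≤ _ := hg
      _ = _ := by ring
  intro t ht
  have hclos : closure (Ico (0:ℝ) τ) = Icc 0 τ := closure_Ico hτ.ne
  refine le_on_closure (s := Ico (0:ℝ) τ) (f := fun t => Ncl (x t))
    (g := fun t => Real.exp (-c * t) * Ncl x₀ + α * (1 - Real.exp (-c * t)) / c * M)
    hIco (hclos ▸ hφc) ?_ (hclos ▸ ht)
  exact Continuous.continuousOn (by fun_prop)

end
end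

section
/- Suppose Assumption 2 holds. Let τ > 0 and q ∈ B_op(R₂). Assume that the ODE ẋ_q(t) = f_q(x_q(t)) with x_q(0) = q has a solution x_q on [0,τ) such that x_q(t) ∈ B_op(R₂) for all t ∈ [0,τ). Then ‖x_q(t) − q‖_op ≤ ν(t)‖q‖_op for all t ∈ [0,τ). -/
set_option autoImplicit false

open Filter Set MeasureTheory Real
open scoped Topology ENNReal

noncomputable section

/-- Copy of `ℝ^n` without a topology. -/
def VSyn (n : ℕ) : Type := Fin n → ℝ

instance vsynGroup (n : ℕ) : AddCommGroup (VSyn n) := inferInstanceAs (AddCommGroup (Fin n → ℝ))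

instance vsynModule (n : ℕ) : Module ℝ (VSyn n) := inferInstanceAs (Module ℝ (Fin n → ℝ))

theorem vecNorm_nonneg {n : ℕ} (N : (Fin n → ℝ) → ℝ) (hN : IsVecNorm N) (x : Fin n → ℝ) :
    0 ≤ N x := by
  have h0 : N 0 = 0 := (hN.eq_zero 0).2 rfl
  have h1 := hN.add_le x ((-1 : ℝ) • x)
  rw [hN.smul_eq, neg_one_smul, add_neg_cancel, h0] at h1
  have h4 : |(-1 : ℝ)| = 1 := by norm_num
  rw [h4] at h1
  linarith

theorem exists_normed {n : ℕ} (N : (Fin n → ℝ) → ℝ) (hN : IsVecNorm N) :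
    ∃ (E : Type) (_ : NormedAddCommGroup E) (_ : NormedSpace ℝ E)
      (φ : (Fin n → ℝ) ≃L[ℝ] E), ∀ x, ‖φ x‖ = N x := by
  let : Norm (VSyn n) := ⟨fun x => N x⟩
  have core : NormedSpace.Core ℝ (VSyn n) :=
    { norm_nonneg := fun x => vecNorm_nonneg N hN x
      norm_smul := fun c x => hN.smul_eq c x
      norm_triangle := fun x y => hN.add_le x y
      norm_eq_zero_iff := fun x => hN.eq_zero x }
  let I1 : NormedAddCommGroup (VSyn n) := NormedAddCommGroup.ofCore core
  let I2 : NormedSpace ℝ (VSyn n) := NormedSpace.ofCore core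
  let ψ : (Fin n → ℝ) ≃ₗ[ℝ] VSyn n := 
    { toFun := fun x => x
      invFun := fun x => x
      left_inv := fun _ => rfl
      right_inv := fun _ => rfl
      map_add' := fun _ _ => rfl
      map_smul' := fun _ _ => rfl }
  refine ⟨VSyn n, I1, I2, ψ.toContinuousLinearEquiv, fun x => rfl⟩

theorem tendsto_logNorm {E : Type} [NormedAddCommGroup E] [NormedSpace ℝ E] [Nontrivial E]
    (A : E →L[ℝ] E) :
    ∃ L, Tendsto (fun ε : ℝ => (‖(1 : E →L[ℝ] E) + ε • A‖ - 1) / ε) (𝓝[>] 0) (𝓝 L) := by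
  refine ⟨_, MonotoneOn.tendsto_nhdsGT ?_ ?_⟩
  · intro a ha b hb hab
    simp only [mem_Ioi] at ha hb
    change (‖(1 : E →L[ℝ] E) + a • A‖ - 1) / a ≤ (‖(1 : E →L[ℝ] E) + b • A‖ - 1) / b
    have e : (1 : E →L[ℝ] E) + a • A = (a / b) • (1 + b • A) + (1 - a / b) • (1 : E →L[ℝ] E) := by
      rw [smul_add, smul_smul, div_mul_cancel₀ _ hb.ne', sub_smul, one_smul]
      abel
    have h1 : a / b ≤ 1 := (div_le_one hb).2 hab
    have h2 : ‖(1 : E →L[ℝ] E) + a • A‖ ≤ (a / b) * ‖(1 : E →L[ℝ] E) + b • A‖ + (1 - a / b) := by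
      calc _ = _ := congrArg _ e
        _ ≤ _ := norm_add_le _ _
        _ = _ := by
          rw [norm_smul, norm_smul, norm_one, Real.norm_of_nonneg (by positivity),
            Real.norm_of_nonneg (by linarith), mul_one]
    rw [div_le_iff₀ ha]
    calc _ ≤ (a / b) * ‖(1 : E →L[ℝ] E) + b • A‖ + (1 - a / b) - 1 := by linarith
      _ = _ := by ring
  · refine ⟨-‖A‖, ?_⟩
    rintro _ ⟨a, ha, rfl⟩
    simp only [mem_Ioi] at ha
    change _ ≤ (‖(1 : E →L[ℝ] E) + a • A‖ - 1) / a
    rw [le_div_iff₀ ha]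
    have h : ‖(1 : E →L[ℝ] E)‖ ≤ ‖(1 : E →L[ℝ] E) + a • A‖ + ‖a • A‖ := by
      calc _ = ‖((1 : E →L[ℝ] E) + a • A) - a • A‖ := by rw [add_sub_cancel_right]
        _ ≤ _ := norm_sub_le _ _
    rw [norm_one, norm_smul, Real.norm_of_nonneg ha.le] at h
    linarith

theorem dini_bound {E : Type} [NormedAddCommGroup E] [NormedSpace ℝ E]
    (A : E →L[ℝ] E) (L : ℝ)
    (hL : Tendsto (fun ε : ℝ => (‖(1 : E →L[ℝ] E) + ε • A‖ - 1) / ε) (𝓝[>] 0) (𝓝 L))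
    (v : ℝ → E) (t : ℝ) (hv : HasDerivWithinAt v (A (v t)) (Ici t) t)
    (r : ℝ) (hr : L * ‖v t‖ < r) :
    ∃ᶠ z in 𝓝[>] t, (z - t)⁻¹ * (‖v z‖ - ‖v t‖) < r := by
  have hv' := (hasDerivWithinAt_iff_tendsto_slope' (s := Ioi t) (by simp)).1
    (hv.mono Ioi_subset_Ici_self)
  have h1 : Tendsto (fun z => z - t) (𝓝[>] t) (𝓝[>] 0) := by
    refine tendsto_nhdsWithin_iff.2 ⟨?_, ?_⟩
    · have : Tendsto (fun z => z - t) (𝓝 t) (𝓝 (t - t)) := by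
        apply Continuous.tendsto; fun_prop
      rw [sub_self] at this
      exact this.mono_left nhdsWithin_le_nhds
    · filter_upwards [self_mem_nhdsWithin] with z hz
      exact sub_pos.2 (mem_Ioi.1 hz)
  have h2 : Tendsto (fun z => (‖(1 : E →L[ℝ] E) + (z - t) • A‖ - 1) / (z - t) * ‖v t‖
      + ‖slope v t z - A (v t)‖) (𝓝[>] t) (𝓝 (L * ‖v t‖ + 0)) := by
    refine ((hL.comp h1).mul_const _).add ?_
    have := (hv'.sub_const (A (v t))).norm
    simpa using this
  rw [add_zero] at h2
  refine Eventually.frequently ?_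
  filter_upwards [h2.eventually_lt_const hr, self_mem_nhdsWithin] with z hz hzt
  refine lt_of_le_of_lt ?_ hz
  have hp : 0 < z - t := sub_pos.2 hzt
  have e : v z = ((1 : E →L[ℝ] E) + (z - t) • A) (v t)
      + (z - t) • (slope v t z - A (v t)) := by
    rw [smul_sub, sub_smul_slope]
    simp
  have h3 : ‖v z‖ ≤ ‖(1 : E →L[ℝ] E) + (z - t) • A‖ * ‖v t‖
      + (z - t) * ‖slope v t z - A (v t)‖ := by
    calc ‖v z‖ = _ := congrArg _ e
      _ ≤ _ := norm_add_le _ _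
      _ ≤ _ := by
        rw [norm_smul, Real.norm_of_nonneg hp.le]
        gcongr
        exact ContinuousLinearMap.le_opNorm _ _
  rw [inv_mul_le_iff₀ hp]
  calc _ ≤ ‖(1 : E →L[ℝ] E) + (z - t) • A‖ * ‖v t‖
      + (z - t) * ‖slope v t z - A (v t)‖ - ‖v t‖ := by linarith
    _ = _ := by field_simp; ring

theorem flow_bound {E : Type} [NormedAddCommGroup E] [NormedSpace ℝ E]
    (A : ℝ → E →L[ℝ] E) (d T : ℝ) (hT : 0 ≤ T) (y v : ℝ → E)
    (hA : ∀ t ∈ Ico 0 T, ∃ L ≤ d,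
      Tendsto (fun ε : ℝ => (‖(1 : E →L[ℝ] E) + ε • A t‖ - 1) / ε) (𝓝[>] 0) (𝓝 L))
    (hyc : ContinuousOn y (Icc 0 T)) (hvc : ContinuousOn v (Icc 0 T))
    (hy : ∀ t ∈ Ico 0 T, HasDerivWithinAt y (v t) (Ici t) t)
    (hv : ∀ t ∈ Ico 0 T, HasDerivWithinAt v (A t (v t)) (Ici t) t)
    (c : ℝ) (hc : ‖v 0‖ ≤ c) :
    ‖y T - y 0‖ ≤ (∫ s in (0:ℝ)..T, Real.exp (d * s)) * c := by
  have hvb : ∀ t ∈ Icc 0 T, ‖v t‖ ≤ c * Real.exp (d * t) := by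
    intro t ht
    have := le_gronwallBound_of_liminf_deriv_right_le (f := fun t => ‖v t‖)
      (f' := fun t => d * ‖v t‖) (δ := c) (K := d) (ε := 0) (a := 0) (b := T) hvc.norm
      (by
        intro x hx r hr
        obtain ⟨L, hLd, hL⟩ := hA x hx
        exact dini_bound (A x) L hL v x (hv x hx) r
          (lt_of_le_of_lt (mul_le_mul_of_nonneg_right hLd (norm_nonneg _)) hr))
      hc (by intro x _; simp) t ht
    simpa [gronwallBound_ε0] using this
  have := image_norm_le_of_norm_deriv_right_le_deriv_boundary (f := fun t => y t - y 0)
    (f' := v) (a := 0) (b := T)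
    (B := fun t => (∫ s in (0:ℝ)..t, Real.exp (d * s)) * c)
    (B' := fun t => Real.exp (d * t) * c)
    (hyc.sub continuousOn_const) (fun t ht => (hy t ht).sub_const _) (by simp)
    (fun t => by
      have hcont : Continuous fun s : ℝ => Real.exp (d * s) := by fun_prop
      exact ((hcont.integral_hasStrictDerivAt 0 t).hasDerivAt).mul_const c)
    (fun t ht => by rw [mul_comm]; exact hvb t (Ico_subset_Icc_self ht))
  exact this (right_mem_Icc.2 hT)

theorem matNorm_eq {n : ℕ} (N : (Fin n → ℝ) → ℝ) {E : Type} [NormedAddCommGroup E]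
    [NormedSpace ℝ E] [Nontrivial E] (φ : (Fin n → ℝ) ≃L[ℝ] E) (hφ : ∀ x, ‖φ x‖ = N x)
    (M : Matrix (Fin n) (Fin n) ℝ) (B : E →L[ℝ] E) (h : ∀ x, φ (M.mulVec x) = B (φ x)) :
    matNorm N M = ‖B‖ := by
  rw [← B.sSup_sphere_eq_norm, matNorm]
  congr 1
  ext c
  constructor
  · rintro ⟨x, hx, rfl⟩
    exact ⟨φ x, by simp [hφ, hx], by simp [← h, hφ]⟩
  · rintro ⟨z, hz, rfl⟩
    refine ⟨φ.symm z, by simpa [← hφ] using hz, by simp [← hφ, h]⟩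

theorem stmt3
    {n m : ℕ} (hn : 0 < n) (hm : 0 < m)
    (f : (Fin n → ℝ) → (Fin m → ℝ) → (Fin n → ℝ)) (g : (Fin n → ℝ) → (Fin m → ℝ))
    (hf : Continuous (fun p : (Fin n → ℝ) × (Fin m → ℝ) => f p.1 p.2)) (hg : Continuous g)
    (hf0 : f 0 (g 0) = 0)
    -- Assumption 2
    (Nop : (Fin n → ℝ) → ℝ) (hNop : IsVecNorm Nop) (d₁ d₂ R₂ : ℝ)
    (hd₁ : 0 ≤ d₁) (hd₂ : 0 < d₂) (hR₂ : 0 < R₂)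
    (hC1 : ∀ q ∈ nball Nop R₂, ContDiffOn ℝ 1 (fun x => f x (g q)) (nball Nop R₂))
    (hmuop : ∀ q ∈ nball Nop R₂, ∀ x ∈ nball Nop R₂,
      logNorm Nop (jacobian (fun y => f y (g q)) x) ≤ d₁)
    (hfqq : ∀ q ∈ nball Nop R₂, Nop (f q (g q)) ≤ d₂ * Nop q)
    (τ : ℝ) (hτ : 0 < τ) (q : Fin n → ℝ) (hq : q ∈ nball Nop R₂)
    (xq : ℝ → (Fin n → ℝ)) (hxq0 : xq 0 = q)
    (hodeq : ∀ t ∈ Ico (0:ℝ) τ, HasDerivWithinAt xq (f (xq t) (g q)) (Ico 0 τ) t)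
    (hxqB : ∀ t ∈ Ico (0:ℝ) τ, xq t ∈ nball Nop R₂) :
    ∀ t ∈ Ico (0:ℝ) τ, Nop (xq t - q) ≤ nu d₁ d₂ t * Nop q := by
  obtain ⟨E, _, _, φ, hφ⟩ := exists_normed Nop hNop
  have : Nonempty (Fin n) := ⟨⟨0, hn⟩⟩
  have : Nontrivial E := φ.injective.nontrivial
  intro T hT
  set F : (Fin n → ℝ) → (Fin n → ℝ) := fun x => f x (g q) with hF
  have hNc : Continuous Nop := by
    have : Nop = fun x => ‖φ x‖ := funext fun x => (hφ x).symm
    rw [this]; fun_prop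
  have hopen : IsOpen (nball Nop R₂) := isOpen_lt hNc continuous_const
  have hFd : ∀ x ∈ nball Nop R₂, HasFDerivAt F (fderiv ℝ F x) x := fun x hx =>
    (((hC1 q hq).differentiableOn one_ne_zero).differentiableAt (hopen.mem_nhds hx)).hasFDerivAt
  have hsub : Icc 0 T ⊆ Ico 0 τ := fun t ht => ⟨ht.1, ht.2.trans_lt hT.2⟩
  have hsub' : Ico 0 T ⊆ Ico 0 τ := Ico_subset_Icc_self.trans hsub
  have hvd : ∀ t ∈ Ico 0 τ, HasDerivWithinAt (fun t => F (xq t))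
      (fderiv ℝ F (xq t) (F (xq t))) (Ico 0 τ) t := fun t ht =>
    (hFd _ (hxqB t ht)).comp_hasDerivWithinAt t (hodeq t ht)
  have hmem : ∀ t ∈ Ico 0 T, Ico 0 τ ∈ 𝓝[≥] t := fun t ht =>
    mem_of_superset (Ico_mem_nhdsGE (hsub' ht).2) (Ico_subset_Ico_left ht.1)
  let A : ℝ → E →L[ℝ] E := fun t =>
    (φ : (Fin n → ℝ) →L[ℝ] E) ∘L (fderiv ℝ F (xq t)) ∘L (φ.symm : E →L[ℝ] (Fin n → ℝ))
  have key := flow_bound A d₁ T hT.1 (fun t => φ (xq t)) (fun t => φ (F (xq t)))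
    (by
      intro t ht
      obtain ⟨L, hL⟩ := tendsto_logNorm (A t)
      refine ⟨L, ?_, hL⟩
      have h1 := hmuop q hq (xq t) (hxqB t (hsub' ht))
      have h2 : ∀ ε : ℝ, matNorm Nop (1 + ε • jacobian F (xq t)) = ‖(1 : E →L[ℝ] E) + ε • A t‖ := by
        intro ε
        refine matNorm_eq Nop φ hφ _ _ fun x => ?_
        have h3 : (jacobian F (xq t)).mulVec x = fderiv ℝ F (xq t) x :=
          LinearMap.toMatrix'_mulVec (fderiv ℝ F (xq t) : (Fin n → ℝ) →ₗ[ℝ] (Fin n → ℝ)) x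
        rw [Matrix.add_mulVec, Matrix.one_mulVec, Matrix.smul_mulVec, h3]
        simp [A]
      have h4 : logNorm Nop (jacobian F (xq t)) = L := by
        unfold logNorm
        simp only [h2]
        exact hL.limUnder_eq
      rw [← h4]; exact h1)
    (φ.continuous.comp_continuousOn fun t ht =>
      ((hodeq t (hsub ht)).continuousWithinAt).mono hsub)
    (φ.continuous.comp_continuousOn fun t ht =>
      ((hvd t (hsub ht)).continuousWithinAt).mono hsub)
    (fun t ht => (φ.toContinuousLinearMap.hasFDerivAt.comp_hasDerivWithinAt t
      ((hodeq t (hsub' ht)).mono_of_mem_nhdsWithin (hmem t ht))))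
    (fun t ht => by
      have := (φ.toContinuousLinearMap.hasFDerivAt.comp_hasDerivWithinAt t
        ((hvd t (hsub' ht)).mono_of_mem_nhdsWithin (hmem t ht)))
      simpa [A] using! this)
    (d₂ * Nop q) (by rw [hφ, hxq0]; exact hfqq q hq)
  rw [← map_sub, hφ, hxq0] at key
  refine key.trans (le_of_eq ?_)
  unfold nu; ring


end
end

section
/- Suppose Assumptions 1, 2, and 4 hold. Define λ₀ := (1+ρ)L_{cl,2}χ₀/(2R). Then λ₀ < 1, and for every λ ∈ (λ₀, 1) and every x ∈ B_cl(R/L_cl), one has Q_log(x) ∈ B_cl(λR). -/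
set_option autoImplicit false

open Filter Set MeasureTheory Real
open scoped Topology ENNReal

noncomputable section

theorem qlog_scalar (ρ χ z w : ℝ) (h0 : 0 < ρ) (h1 : ρ < 1) (hχ : 0 < χ) (hz : 0 < z)
    (hzχ : z < χ)
    (h : ∀ j : ℤ, ρ ^ (j + 1) * χ ≤ z → z < ρ ^ j * χ →
      w = (ρ ^ j * χ + ρ ^ (j + 1) * χ) / 2) : |w| ≤ (1 + ρ) / 2 * χ := by
  obtain ⟨k, hk1, hk2⟩ := exists_mem_Ico_zpow (x := z / χ) (y := ρ⁻¹) (by positivity)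
    ((one_lt_inv₀ h0).2 h1)
  have e1 : ρ⁻¹ ^ k = ρ ^ (-(k + 1) + 1) := by
    rw [inv_zpow']; congr 1; ring
  have e2 : ρ⁻¹ ^ (k + 1) = ρ ^ (-(k + 1)) := by rw [inv_zpow']
  rw [e1, le_div_iff₀ hχ] at hk1
  rw [e2, div_lt_iff₀ hχ] at hk2
  have hw := h _ hk1 hk2
  generalize -(k + 1) = j at *
  have hj : 0 ≤ j := by
    by_contra hj
    have : 1 ≤ ρ ^ (j + 1) := one_le_zpow_of_nonpos₀ h0 h1.le (by lia)
    nlinarith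
  have hle : ρ ^ j ≤ 1 := by
    obtain ⟨k, rfl⟩ := Int.eq_ofNat_of_zero_le hj
    rw [zpow_natCast]
    exact pow_le_one₀ h0.le h1.le
  have hp : 0 < ρ ^ j := zpow_pos h0 j
  rw [zpow_add_one₀ h0.ne'] at hw
  have hw' : w = ρ ^ j * ((1 + ρ) / 2 * χ) := by rw [hw]; ring
  have hb : 0 < (1 + ρ) / 2 * χ := by positivity
  rw [hw', abs_of_pos (by positivity)]
  nlinarith

theorem wnorm_top_eq {n : ℕ} (θ x : Fin n → ℝ) : wnorm ⊤ θ x = ‖fun i => θ i * x i‖ := by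
  unfold wnorm
  exact PiLp.norm_toLp _

theorem stmt7
    {n m : ℕ} (hn : 0 < n) (hm : 0 < m)
    (f : (Fin n → ℝ) → (Fin m → ℝ) → (Fin n → ℝ)) (g : (Fin n → ℝ) → (Fin m → ℝ))
    (hf : Continuous (fun p : (Fin n → ℝ) × (Fin m → ℝ) => f p.1 p.2)) (hg : Continuous g)
    (hf0 : f 0 (g 0) = 0)
    -- Assumption 1
    (Ncl : (Fin n → ℝ) → ℝ) (hNcl : IsVecNorm Ncl) (c R₁ : ℝ) (hc : 0 < c) (hR₁ : 0 < R₁)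
    (hLip : ∀ x ∈ nball Ncl R₁, ∃ (K : NNReal) (ε : ℝ), 0 < ε ∧
      LipschitzOnWith K (fun y => f y (g y)) (Metric.ball x ε ∩ nball Ncl R₁))
    (hmucl : ∀ᵐ x ∂(volume : Measure (Fin n → ℝ)), x ∈ nball Ncl R₁ →
      DifferentiableAt ℝ (fun y => f y (g y)) x ∧
      logNorm Ncl (jacobian (fun y => f y (g y)) x) ≤ -c)
    -- Assumption 2
    (Nop : (Fin n → ℝ) → ℝ) (hNop : IsVecNorm Nop) (d₁ d₂ R₂ : ℝ)
    (hd₁ : 0 ≤ d₁) (hd₂ : 0 < d₂) (hR₂ : 0 < R₂)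
    (hC1 : ∀ q ∈ nball Nop R₂, ContDiffOn ℝ 1 (fun x => f x (g q)) (nball Nop R₂))
    (hmuop : ∀ q ∈ nball Nop R₂, ∀ x ∈ nball Nop R₂,
      logNorm Nop (jacobian (fun y => f y (g q)) x) ≤ d₁)
    (hfqq : ∀ q ∈ nball Nop R₂, Nop (f q (g q)) ≤ d₂ * Nop q)
    -- the constants Γ and R
    (Γ R : ℝ) (hΓ : 0 < Γ) (hΓle : ∀ x : Fin n → ℝ, Nop x ≤ Γ * Ncl x)
    (hR : R = min R₁ (R₂ / Γ))
    -- equivalence of ‖·‖_cl with a diagonally-weighted ∞-norm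
    (θcl : Fin n → ℝ) (hθcl : ∀ i, 0 < θcl i)
    (Lcl1 Lcl2 : ℝ) (hLcl1 : 0 < Lcl1) (hLcl2 : 0 < Lcl2)
    (hclEquiv : ∀ x : Fin n → ℝ,
      Lcl1 * wnorm ⊤ θcl x ≤ Ncl x ∧ Ncl x ≤ Lcl2 * wnorm ⊤ θcl x)
    (Lcl : ℝ) (hLcl : Lcl = Lcl2 / Lcl1)
    (ρ : ℝ) (hρ : 0 < ρ ∧ ρ < 1)
    -- Assumption 4
    (χ₀ : ℝ) (hχ₀pos : 0 < χ₀) (hχ₀ : R / Lcl2 ≤ χ₀ ∧ χ₀ < 2 * R / (Lcl2 * (1 + ρ)))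
    -- the logarithmic quantizer with density ρ and parameters χ_{i,0} = χ₀ / θcl i
    (Qlog : (Fin n → ℝ) → (Fin n → ℝ))
    (hQ0 : ∀ (x : Fin n → ℝ) (i : Fin n), x i = 0 → Qlog x i = 0)
    (hQpos : ∀ (x : Fin n → ℝ) (i : Fin n) (j : ℤ),
      ρ ^ (j + 1) * (χ₀ / θcl i) ≤ x i → x i < ρ ^ j * (χ₀ / θcl i) →
      Qlog x i = (ρ ^ j * (χ₀ / θcl i) + ρ ^ (j + 1) * (χ₀ / θcl i)) / 2)
    (hQneg : ∀ (x : Fin n → ℝ) (i : Fin n), x i < 0 → Qlog x i = - Qlog (-x) i)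
    (lam₀ : ℝ) (hlam₀ : lam₀ = (1 + ρ) * Lcl2 * χ₀ / (2 * R)) :
    lam₀ < 1 ∧
    ∀ lam : ℝ, lam₀ < lam → lam < 1 →
      ∀ x : Fin n → ℝ, Ncl x < R / Lcl → Ncl (Qlog x) < lam * R := by
  have hR0 : 0 < R := by rw [hR]; exact lt_min hR₁ (div_pos hR₂ hΓ)
  obtain ⟨h0, h1⟩ := hρ
  obtain ⟨ha, hb⟩ := hχ₀
  have hl : lam₀ * R = Lcl2 * ((1 + ρ) / 2 * χ₀) := by
    rw [hlam₀]; field_simp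
  refine ⟨?_, ?_⟩
  · rw [lt_div_iff₀ (by positivity)] at hb
    rw [hlam₀, div_lt_one (by positivity)]
    linarith
  intro lam hlam _ x hx
  have hw : wnorm ⊤ θcl x < χ₀ := by
    refine lt_of_lt_of_le ?_ ha
    have := (hclEquiv x).1.trans_lt hx
    rw [hLcl] at this
    have e : R / (Lcl2 / Lcl1) = Lcl1 * (R / Lcl2) := by field_simp
    rw [e] at this
    exact lt_of_mul_lt_mul_left this hLcl1.le
  have hxi : ∀ i, |x i| < χ₀ / θcl i := by
    intro i
    rw [wnorm_top_eq] at hw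
    have := (norm_le_pi_norm (fun i => θcl i * x i) i).trans_lt hw
    rw [Real.norm_eq_abs, abs_mul, abs_of_pos (hθcl i)] at this
    rw [lt_div_iff₀ (hθcl i)]
    linarith
  have hpos : ∀ (y : Fin n → ℝ) (i : Fin n), 0 < y i → y i < χ₀ / θcl i →
      |Qlog y i| ≤ (1 + ρ) / 2 * (χ₀ / θcl i) := fun y i h h' =>
    qlog_scalar ρ _ (y i) _ h0 h1 (div_pos hχ₀pos (hθcl i)) h h' (hQpos y i)
  have hQ : ∀ i, |Qlog x i| ≤ (1 + ρ) / 2 * (χ₀ / θcl i) := by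
    intro i
    have hi := abs_lt.1 (hxi i)
    rcases lt_trichotomy (x i) 0 with h | h | h
    · rw [hQneg x i h, abs_neg]
      apply hpos (-x) i
      · simpa using h
      · simp only [Pi.neg_apply]; linarith
    · rw [hQ0 x i h, abs_zero]
      have := hθcl i
      positivity
    · exact hpos x i h hi.2
  have hwQ : wnorm ⊤ θcl (Qlog x) ≤ (1 + ρ) / 2 * χ₀ := by
    rw [wnorm_top_eq, pi_norm_le_iff_of_nonneg (by positivity)]
    intro i
    rw [Real.norm_eq_abs, abs_mul, abs_of_pos (hθcl i)]
    have := mul_le_mul_of_nonneg_left (hQ i) (hθcl i).le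
    refine this.trans_eq ?_
    have := (hθcl i).ne'
    field_simp
  calc Ncl (Qlog x) ≤ Lcl2 * wnorm ⊤ θcl (Qlog x) := (hclEquiv _).2
    _ ≤ Lcl2 * ((1 + ρ) / 2 * χ₀) := mul_le_mul_of_nonneg_left hwQ hLcl2.le
    _ = lam₀ * R := hl.symm
    _ < lam * R := mul_lt_mul_of_pos_right hlam hR0

end
end

section
/- Let ε ∈ (0,1) and c, τ_max > 0, and define w(t) := e^{−ct}(1−ε) + ε for t ≥ 0 and γ := −log(w(τ_max))/τ_max. Then γ > 0 and w(t) ≤ e^{−γt} for all t ∈ [0, τ_max]. -/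
set_option autoImplicit false

theorem stmt9 (ε c τmax : ℝ) (hε : 0 < ε ∧ ε < 1) (hc : 0 < c) (hτmax : 0 < τmax)
    (w : ℝ → ℝ) (hw : ∀ t : ℝ, w t = Real.exp (-c * t) * (1 - ε) + ε)
    (γ : ℝ) (hγ : γ = -Real.log (w τmax) / τmax) :
    0 < γ ∧ ∀ t ∈ Set.Icc (0:ℝ) τmax, w t ≤ Real.exp (-γ * t) := by
  obtain ⟨h0, h1⟩ := hε
  have hE : Real.exp (-c * τmax) < 1 := by
    rw [Real.exp_lt_one_iff]
    nlinarith [mul_pos hc hτmax]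
  have hE0 := Real.exp_pos (-c * τmax)
  have hwpos : 0 < w τmax := by
    rw [hw]
    have : 0 < 1 - ε := by linarith
    positivity
  have hw1 : w τmax < 1 := by
    rw [hw]
    nlinarith
  refine ⟨?_, ?_⟩
  · rw [hγ]
    exact div_pos (by linarith [Real.log_neg hwpos hw1]) hτmax
  · rintro t ⟨ht0, ht1⟩
    have hs0 : 0 ≤ t / τmax := div_nonneg ht0 hτmax.le
    have hs1 : t / τmax ≤ 1 := (div_le_one hτmax).2 ht1
    have key := (Real.concaveOn_rpow hs0 hs1).2 (Set.mem_Ici.2 hE0.le)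
      (Set.mem_Ici.2 (zero_le_one' ℝ)) (by linarith : 0 ≤ 1 - ε) h0.le (by ring)
    simp only [smul_eq_mul, Real.one_rpow, mul_one] at key
    have e1 : Real.exp (-c * τmax) ^ (t / τmax) = Real.exp (-c * t) := by
      rw [← Real.exp_mul]
      congr 1
      field_simp
    have e2 : (1 - ε) * Real.exp (-c * τmax) + ε = w τmax := by
      rw [hw]; ring
    have e3 : w τmax ^ (t / τmax) = Real.exp (-γ * t) := by
      rw [Real.rpow_def_of_pos hwpos, hγ]
      congr 1
      field_simp
    rw [e1, e2, e3] at key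
    rw [hw]
    linarith
end

section
/- Let ε ∈ (0,1) and c > 0, and define W(t) := −log(e^{−ct}(1−ε) + ε)/t for t > 0. Then W is strictly decreasing on (0,∞); in particular W'(t) < 0 for every t > 0. -/
set_option autoImplicit false

theorem stmt10 (ε c : ℝ) (hε : 0 < ε ∧ ε < 1) (hc : 0 < c)
    (W : ℝ → ℝ)
    (hW : ∀ t : ℝ, W t = -Real.log (Real.exp (-c * t) * (1 - ε) + ε) / t) :
    StrictAntiOn W (Set.Ioi 0) ∧ ∀ t : ℝ, 0 < t → deriv W t < 0 := by
  obtain ⟨h0, h1⟩ := hε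
  have hW' : W = fun t : ℝ => -Real.log (Real.exp (-c * t) * (1 - ε) + ε) / t := funext hW
  have hpos : ∀ t : ℝ, 0 < Real.exp (-c * t) * (1 - ε) + ε := by
    intro t
    have := mul_pos (Real.exp_pos (-c * t)) (sub_pos.2 h1)
    linarith
  have key : ∀ t : ℝ, 0 < t → ∃ d : ℝ, d < 0 ∧ HasDerivAt W d t := by
    intro t ht
    have hlin : HasDerivAt (fun s : ℝ => -c * s) (-c) t := by
      simpa using (hasDerivAt_id t).const_mul (-c)
    have hd := (((hlin.exp.mul_const (1 - ε)).add_const ε).log (hpos t).ne').neg.div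
      (hasDerivAt_id t) ht.ne'
    refine ⟨_, ?_, by rw [hW']; exact hd⟩
    have hE : Real.exp (-c * t) ≠ 1 := by
      have : Real.exp (-c * t) < 1 := Real.exp_lt_one_iff.2 (by nlinarith)
      exact this.ne
    have hconv := Real.strictConvexOn_mul_log.2 (x := Real.exp (-c * t)) (y := 1)
      (Set.mem_Ici.2 (Real.exp_pos _).le) (Set.mem_Ici.2 zero_le_one) hE
      (sub_pos.2 h1) h0 (by ring)
    simp only [smul_eq_mul, Real.log_exp, Real.log_one, mul_one, mul_zero, add_zero] at hconv
    rw [mul_comm (1 - ε) (Real.exp (-c * t))] at hconv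
    have hg := hpos t
    apply div_neg_of_neg_of_pos _ (by simp only [id]; positivity)
    simp only [id, Pi.neg_apply]
    generalize Real.exp (-c * t) = E at *
    have h2 : Real.log (E * (1 - ε) + ε) < (1 - ε) * (E * (-c * t)) / (E * (1 - ε) + ε) := by
      rw [lt_div_iff₀ hg]; linarith
    have h3 : -(E * -c * (1 - ε) / (E * (1 - ε) + ε)) * t
        = -((1 - ε) * (E * (-c * t)) / (E * (1 - ε) + ε)) := by ring
    linarith
  have hneg : ∀ t : ℝ, 0 < t → deriv W t < 0 := by
    intro t ht
    obtain ⟨d, hd, h⟩ := key t ht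
    rwa [h.deriv]
  refine ⟨strictAntiOn_of_deriv_neg (convex_Ioi 0) ?_ ?_, hneg⟩
  · intro t ht
    obtain ⟨d, _, h⟩ := key t ht
    exact h.continuousAt.continuousWithinAt
  · intro t ht
    rw [interior_Ioi] at ht
    exact hneg t ht
end
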